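/- For every group-theoretical category of partitions C, the set F(C) is a normal subgroup of Z_2^{*∞}. -/

import Mathlib

open Classical

/-- A partition diagram with `upper` upper points and `lower` lower points; the blocks are
encoded by the equivalence relation (setoid) on the disjoint union of the points. -/
structure PartitionDiagram where
  upper : ℕ
  lower : ℕ
  rel : Setoid (Fin upper ⊕ Fin lower)

namespace PartitionDiagram

/-- The partition determined by a labelling of the points: two points lie in the same block
iff they receive the same label. -/
def ofLabels {u l : ℕ} (f : Fin u ⊕ Fin l → ℕ) : PartitionDiagram :=
  ⟨u, l, Setoid.ker f⟩

/-- The identity partition `| ∈ P(1,1)`. -/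
def idPartition : PartitionDiagram := ofLabels (u := 1) (l := 1) fun _ => 0

/-- The pair partition `⊓ ∈ P(0,2)`. -/
def pairPartition : PartitionDiagram := ofLabels (u := 0) (l := 2) fun _ => 0

/-- The four block partition `⊓⊓ ∈ P(0,4)`. -/
def fourBlock : PartitionDiagram := ofLabels (u := 0) (l := 4) fun _ => 0

/-- The singleton partition `↑ ∈ P(0,1)`. -/
def singletonPartition : PartitionDiagram := ofLabels (u := 0) (l := 1) fun _ => 0

/-- The double singleton partition `↑⊗↑ ∈ P(0,2)`. -/
def doubleSingleton : PartitionDiagram :=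
  ofLabels (u := 0) (l := 2) (Sum.elim (fun i => (i : ℕ)) fun j => (j : ℕ))

/-- The crossing partition `⨯ ∈ P(2,2)`, with blocks `{1,2'}` and `{2,1'}`. -/
def crossing : PartitionDiagram :=
  ofLabels (u := 2) (l := 2) (Sum.elim (fun i => (i : ℕ)) fun j => 1 - (j : ℕ))

/-- The pair positioner partition `▷ ∈ P(3,3)`, with blocks `{1,2,2',3'}` and `{3,1'}`. -/
def pairPositioner : PartitionDiagram :=
  ofLabels (u := 3) (l := 3)
    (Sum.elim (fun i => if (i : ℕ) = 2 then 1 else 0) fun j => if (j : ℕ) = 0 then 1 else 0)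

/-- The partition `k_l ∈ P(l+2, l+2)` consisting of the four block `{1, 1', l+2, (l+2)'}`
together with the pairs `{j, j'}` for `2 ≤ j ≤ l+1`. -/
def kPart (n : ℕ) : PartitionDiagram :=
  ofLabels (u := n + 2) (l := n + 2)
    (fun x => if (Sum.elim Fin.val Fin.val x) = 0 ∨ (Sum.elim Fin.val Fin.val x) = n + 1
      then 0 else Sum.elim Fin.val Fin.val x)

/-- The involution `p* ∈ P(l,k)` of `p ∈ P(k,l)`: turn the partition upside down. -/
def invol (p : PartitionDiagram) : PartitionDiagram :=
  ⟨p.lower, p.upper, Setoid.comap Sum.swap p.rel⟩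

/-- Auxiliary map splitting the points of a tensor product into the points of the two factors. -/
def splitPoint {a b c d : ℕ} (x : Fin (a + b) ⊕ Fin (c + d)) :
    (Fin a ⊕ Fin c) ⊕ (Fin b ⊕ Fin d) :=
  match x with
  | Sum.inl u =>
    match finSumFinEquiv.symm u with
    | Sum.inl i => Sum.inl (Sum.inl i)
    | Sum.inr i => Sum.inr (Sum.inl i)
  | Sum.inr v =>
    match finSumFinEquiv.symm v with
    | Sum.inl j => Sum.inl (Sum.inr j)
    | Sum.inr j => Sum.inr (Sum.inr j)

/-- The tensor product (horizontal concatenation) `p ⊗ q` of two partitions. -/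
def tensor (p q : PartitionDiagram) : PartitionDiagram :=
  ⟨p.upper + q.upper, p.lower + q.lower,
    Setoid.ker fun x =>
      Sum.map (Quotient.mk p.rel) (Quotient.mk q.rel) (splitPoint x)⟩

section Composition

variable (p q : PartitionDiagram) (h : p.lower = q.upper)

/-- Inclusion of the points of `p` into the three-row diagram used for composition. -/
def iotaP : Fin p.upper ⊕ Fin p.lower → Fin p.upper ⊕ (Fin p.lower ⊕ Fin q.lower) :=
  Sum.map id Sum.inl

/-- Inclusion of the points of `q` into the three-row diagram used for composition,
identifying the upper points of `q` with the lower points of `p`. -/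
def iotaQ : Fin q.upper ⊕ Fin q.lower → Fin p.upper ⊕ (Fin p.lower ⊕ Fin q.lower) :=
  fun x => Sum.inr (Sum.map (Fin.cast h.symm) id x)

/-- The generating relation on the three-row diagram used for composition. -/
def compRel : Fin p.upper ⊕ (Fin p.lower ⊕ Fin q.lower) →
    Fin p.upper ⊕ (Fin p.lower ⊕ Fin q.lower) → Prop :=
  fun x y =>
    (∃ a b, p.rel.r a b ∧ x = iotaP p q a ∧ y = iotaP p q b) ∨
    (∃ a b, q.rel.r a b ∧ x = iotaQ p q h a ∧ y = iotaQ p q h b)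

/-- The composition (vertical concatenation) `qp ∈ P(k,m)` of `p ∈ P(k,l)` and `q ∈ P(l,m)`:
identify the lower points of `p` with the upper points of `q`, take the join of the block
structures and restrict to the upper points of `p` and the lower points of `q`. -/
def comp : PartitionDiagram :=
  ⟨p.upper, q.lower,
    Setoid.comap (Sum.map id Sum.inr) (Relation.EqvGen.setoid (compRel p q h))⟩

end Composition

/-- Rotation of the leftmost upper point to the leftmost lower position. -/
def rotLU (p : PartitionDiagram) (h : 0 < p.upper) : PartitionDiagram :=
  ⟨p.upper - 1, p.lower + 1,
    Setoid.comap (fun x => match x with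
      | Sum.inl j => Sum.inl (⟨(j : ℕ) + 1, by have := j.isLt; omega⟩ : Fin p.upper)
      | Sum.inr j => if hj : (j : ℕ) = 0 then Sum.inl (⟨0, h⟩ : Fin p.upper)
          else Sum.inr (⟨(j : ℕ) - 1, by have := j.isLt; omega⟩ : Fin p.lower)) p.rel⟩

/-- Rotation of the leftmost lower point to the leftmost upper position. -/
def rotLD (p : PartitionDiagram) (h : 0 < p.lower) : PartitionDiagram :=
  ⟨p.upper + 1, p.lower - 1,
    Setoid.comap (fun x => match x with
      | Sum.inl j => if hj : (j : ℕ) = 0 then Sum.inr (⟨0, h⟩ : Fin p.lower)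
          else Sum.inl (⟨(j : ℕ) - 1, by have := j.isLt; omega⟩ : Fin p.upper)
      | Sum.inr j => Sum.inr (⟨(j : ℕ) + 1, by have := j.isLt; omega⟩ : Fin p.lower)) p.rel⟩

/-- Rotation of the rightmost upper point to the rightmost lower position. -/
def rotRU (p : PartitionDiagram) (h : 0 < p.upper) : PartitionDiagram :=
  ⟨p.upper - 1, p.lower + 1,
    Setoid.comap (fun x => match x with
      | Sum.inl j => Sum.inl (⟨(j : ℕ), by have := j.isLt; omega⟩ : Fin p.upper)
      | Sum.inr j => if hj : (j : ℕ) < p.lower then Sum.inr (⟨(j : ℕ), hj⟩ : Fin p.lower)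
          else Sum.inl (⟨p.upper - 1, by omega⟩ : Fin p.upper)) p.rel⟩

/-- Rotation of the rightmost lower point to the rightmost upper position. -/
def rotRD (p : PartitionDiagram) (h : 0 < p.lower) : PartitionDiagram :=
  ⟨p.upper + 1, p.lower - 1,
    Setoid.comap (fun x => match x with
      | Sum.inl j => if hj : (j : ℕ) < p.upper then Sum.inl (⟨(j : ℕ), hj⟩ : Fin p.upper)
          else Sum.inr (⟨p.lower - 1, by omega⟩ : Fin p.lower)
      | Sum.inr j => Sum.inr (⟨(j : ℕ), by have := j.isLt; omega⟩ : Fin p.lower)) p.rel⟩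

/-- The partition obtained from `p` by merging the block of the point `a` and the block of
the point `b` into a single block, leaving all other blocks unchanged. -/
noncomputable def mergeBlocks (p : PartitionDiagram)
    (a b : Fin p.upper ⊕ Fin p.lower) : PartitionDiagram :=
  ⟨p.upper, p.lower,
    Setoid.ker fun x =>
      if p.rel.r x a ∨ p.rel.r x b then (none : Option (Quotient p.rel))
      else some (Quotient.mk p.rel x)⟩

end PartitionDiagram

open PartitionDiagram

/-- A set of partitions is a category of partitions if it contains the identity partition and
the pair partition and is closed under tensor products, composition, involution and the four
rotation operations. -/
structure IsPartitionCategory (M : Set PartitionDiagram) : Prop where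
  id_mem : idPartition ∈ M
  pair_mem : pairPartition ∈ M
  tensor_mem : ∀ p ∈ M, ∀ q ∈ M, tensor p q ∈ M
  comp_mem : ∀ p ∈ M, ∀ q ∈ M, ∀ h : p.lower = q.upper, comp p q h ∈ M
  invol_mem : ∀ p ∈ M, invol p ∈ M
  rotLU_mem : ∀ p ∈ M, ∀ h : 0 < p.upper, rotLU p h ∈ M
  rotLD_mem : ∀ p ∈ M, ∀ h : 0 < p.lower, rotLD p h ∈ M
  rotRU_mem : ∀ p ∈ M, ∀ h : 0 < p.upper, rotRU p h ∈ M
  rotRD_mem : ∀ p ∈ M, ∀ h : 0 < p.lower, rotRD p h ∈ M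

/-- A category of partitions is group-theoretical if it contains the pair positioner
partition `▷`. -/
def IsGroupTheoreticalCategory (M : Set PartitionDiagram) : Prop :=
  IsPartitionCategory M ∧ pairPositioner ∈ M

/-- The smallest category of partitions containing a given set of partitions. -/
def generatedCategory (S : Set PartitionDiagram) : Set PartitionDiagram :=
  ⋂₀ { M | IsPartitionCategory M ∧ S ⊆ M }

/-- The group `Z_2^{*∞}`: the free product of countably many copies of the cyclic group of
order two. -/
abbrev FreeZ2 := Monoid.CoprodI (fun _ : ℕ => Multiplicative (ZMod 2))

/-- The free generators `a_1, a_2, …` of `Z_2^{*∞}`, each of order two. -/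
def gen (n : ℕ) : FreeZ2 :=
  Monoid.CoprodI.of (i := n) (Multiplicative.ofAdd (1 : ZMod 2))

/-- A labelling of a partition assigns (indices of) pairwise distinct generators of
`Z_2^{*∞}` to the blocks: two points receive the same label iff they lie in the same block. -/
def IsLabelling (p : PartitionDiagram) (lab : Fin p.upper ⊕ Fin p.lower → ℕ) : Prop :=
  ∀ x y, lab x = lab y ↔ p.rel.r x y

/-- The word `w(p,l) ∈ Z_2^{*∞}` of a labelled partition: after rotating all upper points to
the right-hand end of the lower row, read off the generators assigned to the points from left
to right, i.e. read the lower points from left to right and then the upper points from right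
to left. -/
def wordOf (p : PartitionDiagram) (lab : Fin p.upper ⊕ Fin p.lower → ℕ) : FreeZ2 :=
  ((List.ofFn fun j : Fin p.lower => gen (lab (Sum.inr j))) ++
    (List.ofFn fun i : Fin p.upper => gen (lab (Sum.inl i))).reverse).prod

/-- `F(C) ⊆ Z_2^{*∞}` is the set of all `w(p,l)` where `p ∈ C` and `l` is a labelling. -/
def Fmap (M : Set PartitionDiagram) : Set FreeZ2 :=
  { g | ∃ p ∈ M, ∃ lab, IsLabelling p lab ∧ wordOf p lab = g }

/-- The set of partitions admitting a labelling whose word lies in `H`. -/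
def catOf (H : Set FreeZ2) : Set PartitionDiagram :=
  { p | ∃ lab, IsLabelling p lab ∧ wordOf p lab ∈ H }

/-- The endomorphism of `Z_2^{*∞}` identifying letters according to `f`, i.e. sending
`a_k` to `a_{f k}` for every `k`. -/
def identifyLetters (f : ℕ → ℕ) : Monoid.End FreeZ2 :=
  Monoid.CoprodI.lift fun i =>
    (Monoid.CoprodI.of (M := fun _ : ℕ => Multiplicative (ZMod 2)) (i := f i))

/-- The strong symmetric semigroup `sS_∞`: the subsemigroup of `End(Z_2^{*∞})` generated by
the finite identifications of letters. -/
def strongSymmetricSemigroup : Subsemigroup (Monoid.End FreeZ2) :=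
  Subsemigroup.closure
    { φ | ∃ f : ℕ → ℕ, (∃ n : ℕ, ∀ k, n ≤ k → f k = k) ∧ φ = identifyLetters f }

/-- A subset of `Z_2^{*∞}` is `sS_∞`-invariant if it is preserved by every element of the
strong symmetric semigroup. -/
def IsSSInvariant (H : Set FreeZ2) : Prop :=
  ∀ φ ∈ strongSymmetricSemigroup, ∀ g ∈ H, φ g ∈ H

/-- A partition is in single leg form if it has no upper points and no two consecutive
points belong to the same block. -/
def IsSingleLeg (p : PartitionDiagram) : Prop :=
  p.upper = 0 ∧
    ∀ i j : Fin p.lower, (j : ℕ) = (i : ℕ) + 1 → ¬ p.rel.r (Sum.inr i) (Sum.inr j)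

/-- `C_sl`: the set of all partitions in `C` with no upper points in single leg form. -/
def slSet (M : Set PartitionDiagram) : Set PartitionDiagram :=
  { p ∈ M | IsSingleLeg p }

/-- The partition with no upper points determined by a word (a list of letters): two points
lie in the same block iff the corresponding letters coincide. -/
def wordPartition (w : List ℕ) : PartitionDiagram :=
  ofLabels (u := 0) (l := w.length) (Sum.elim (fun i => (i : ℕ)) fun j => w.get j)

/-- The canonical letter of the block of a lower point: the least index of a point in its
block. -/
noncomputable def blockLabel (p : PartitionDiagram) (j : Fin p.lower) : ℕ :=
  sInf { i : ℕ | ∃ h : i < p.lower, p.rel.r (Sum.inr ⟨i, h⟩) (Sum.inr j) }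

/-- The canonical word of a partition with no upper points. -/
noncomputable def canonWord (p : PartitionDiagram) : List ℕ :=
  List.ofFn fun j : Fin p.lower => blockLabel p j

/-- Full reduction of a word over an alphabet of involutions: repeatedly delete adjacent
equal pairs of letters.  This computes the result of iterating the operation replacing every
exponent in the run-decomposition of the word by its parity. -/
def reduceWord (w : List ℕ) : List ℕ :=
  w.foldr (fun x acc => match acc with
    | [] => [x]
    | y :: rest => if x = y then rest else x :: y :: rest) []

/-- The single leg version of a partition with no upper points: the unique partition in
single leg form obtained by iteratively replacing every exponent in its run-decomposition by
its parity. -/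
noncomputable def singleLegVersion (p : PartitionDiagram) : PartitionDiagram :=
  wordPartition (reduceWord (canonWord p))

namespace PartitionDiagram

/-- The label of a point when the upper row is labelled by `s` and the lower row by `t`. -/
def rowLabel (s t : List ℕ) {u l : ℕ} : Fin u ⊕ Fin l → Option ℕ :=
  Sum.elim (fun i => s[(i : ℕ)]?) fun j => t[(j : ℕ)]?

/-- The blocks of `p` are the fibres of the labelling of the upper row by `s` and of the lower
row by `t`. -/
def HasRows (p : PartitionDiagram) (s t : List ℕ) : Prop :=
  p.upper = s.length ∧ p.lower = t.length ∧
    ∀ x y, p.rel.r x y ↔ rowLabel s t x = rowLabel s t y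

namespace HasRows

theorem comap {p : PartitionDiagram} {s t s' t' : List ℕ} (hp : HasRows p s t) {u l : ℕ}
    (φ : Fin u ⊕ Fin l → Fin p.upper ⊕ Fin p.lower) (hu : u = s'.length) (hl : l = t'.length)
    (hφ : ∀ x, rowLabel s t (φ x) = rowLabel s' t' x) :
    HasRows ⟨u, l, Setoid.comap φ p.rel⟩ s' t' :=
  ⟨hu, hl, fun x y => (hp.2.2 (φ x) (φ y)).trans (by rw [hφ, hφ])⟩

theorem ofLabels {u l : ℕ} {f : Fin u ⊕ Fin l → ℕ} {s t : List ℕ} (hu : u = s.length)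
    (hl : l = t.length) (g : ℕ → ℕ) (hf : ∀ x, rowLabel s t x = some (g (f x)))
    (hg : ∀ x y, g (f x) = g (f y) → f x = f y) : HasRows (PartitionDiagram.ofLabels f) s t :=
  ⟨hu, hl, fun x y =>
    ⟨fun h => (hf x).trans ((congrArg (some ∘ g) h).trans (hf y).symm),
      fun h => hg x y (Option.some_inj.1 ((hf x).symm.trans (h.trans (hf y))))⟩⟩

theorem invol {p : PartitionDiagram} {s t : List ℕ} (hp : HasRows p s t) :
    HasRows p.invol t s := by
  refine hp.comap _ hp.2.1 hp.1 ?_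
  rintro (x | x) <;> rfl

theorem rotLU {p : PartitionDiagram} {a : ℕ} {s t : List ℕ}
    (hp : HasRows p (a :: s) t) (h : 0 < p.upper) : HasRows (p.rotLU h) s (a :: t) := by
  refine hp.comap _ (by simp [hp.1]) (by simp [hp.2.1]) ?_
  rintro (⟨i, hi⟩ | ⟨_ | i, hi⟩) <;> simp [rowLabel]

theorem rotLD {p : PartitionDiagram} {a : ℕ} {s t : List ℕ}
    (hp : HasRows p s (a :: t)) (h : 0 < p.lower) : HasRows (p.rotLD h) (a :: s) t := by
  refine hp.comap _ (by simp [hp.1]) (by simp [hp.2.1]) ?_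
  rintro (⟨_ | i, hi⟩ | ⟨i, hi⟩) <;> simp [rowLabel]

theorem rotRU {p : PartitionDiagram} {a : ℕ} {s t : List ℕ}
    (hp : HasRows p (s ++ [a]) t) (h : 0 < p.upper) : HasRows (p.rotRU h) s (t ++ [a]) := by
  have hu : p.upper = s.length + 1 := by simp [hp.1]
  have hl := hp.2.1
  refine hp.comap _ (by omega) (by simp [hl]) ?_
  rintro (⟨i, hi⟩ | ⟨i, hi⟩)
  · simp only [rowLabel, Sum.elim_inl]
    rw [List.getElem?_append_left (by omega)]
  · by_cases h' : i < p.lower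
    · simp only [rowLabel, h', dif_pos, Sum.elim_inr]
      rw [List.getElem?_append_left (by omega)]
    · obtain rfl : i = t.length := by omega
      simp [rowLabel, hu, hl]

theorem rotRD {p : PartitionDiagram} {a : ℕ} {s t : List ℕ}
    (hp : HasRows p s (t ++ [a])) (h : 0 < p.lower) : HasRows (p.rotRD h) (s ++ [a]) t := by
  have hl : p.lower = t.length + 1 := by simp [hp.2.1]
  have hu := hp.1
  refine hp.comap _ (by simp [hu]) (by omega) ?_
  rintro (⟨i, hi⟩ | ⟨i, hi⟩)
  · by_cases h' : i < p.upper
    · simp only [rowLabel, h', dif_pos, Sum.elim_inl]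
      rw [List.getElem?_append_left (by omega)]
    · obtain rfl : i = s.length := by omega
      simp [rowLabel, hu, hl]
  · simp only [rowLabel, Sum.elim_inr]
    rw [List.getElem?_append_left (by omega)]

theorem map {p : PartitionDiagram} {s t : List ℕ} (hp : HasRows p s t) {f : ℕ → ℕ}
    (hf : Function.Injective f) : HasRows p (s.map f) (t.map f) := by
  refine ⟨by simp [hp.1], by simp [hp.2.1], fun x y => (hp.2.2 x y).trans ?_⟩
  have key : ∀ x : Fin p.upper ⊕ Fin p.lower,
      rowLabel (s.map f) (t.map f) x = (rowLabel s t x).map f := by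
    rintro (x | x) <;> simp [rowLabel]
  rw [key, key, (Option.map_injective hf).eq_iff]

/-- Composition of labelled partitions. The middle row carries the labels `t` in the first
factor and `t'` in the second one, and `σ` identifies the latter with the former. -/
theorem comp {p q : PartitionDiagram} {s t t' r : List ℕ} (hp : HasRows p s t)
    (hq : HasRows q t' r) (h : p.lower = q.upper) (σ : ℕ → ℕ) (hσ : t'.map σ = t)
    (hinj : ∀ x ∈ t' ++ r, ∀ y ∈ t' ++ r, σ x = σ y → x = y ∨ x ∈ t' ∧ y ∈ t')
    (hs : ∀ a ∈ s, a ∈ r.map σ → a ∈ t) : HasRows (p.comp q h) s (r.map σ) := by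
  obtain ⟨hpu, hpl, hpr⟩ := hp
  obtain ⟨hqu, hql, hqr⟩ := hq
  refine ⟨hpu, by simpa [PartitionDiagram.comp] using hql, ?_⟩
  let F : Fin p.upper ⊕ (Fin p.lower ⊕ Fin q.lower) → Option ℕ :=
    Sum.elim (fun i => s[(i : ℕ)]?) (rowLabel t (r.map σ))
  let E := Relation.EqvGen.setoid (compRel p q h)
  have hFP : ∀ a, F (iotaP p q a) = rowLabel s t a := by
    rintro (a | a) <;> rfl
  have hFQ : ∀ a, F (iotaQ p q h a) = (rowLabel t' r a).map σ := by
    rintro (a | a) <;> simp [F, iotaQ, rowLabel, ← hσ]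
  have EP : ∀ a b, rowLabel s t a = rowLabel s t b → E (iotaP p q a) (iotaP p q b) :=
    fun a b hab => .rel _ _ (.inl ⟨a, b, (hpr a b).2 hab, rfl, rfl⟩)
  have EQ : ∀ a b, rowLabel t' r a = rowLabel t' r b → E (iotaQ p q h a) (iotaQ p q h b) :=
    fun a b hab => .rel _ _ (.inr ⟨a, b, (hqr a b).2 hab, rfl, rfl⟩)
  have sound : ∀ x y, E x y → F x = F y := by
    intro x y hxy
    induction hxy with
    | rel x y hxy =>
      obtain ⟨a, b, hab, rfl, rfl⟩ | ⟨a, b, hab, rfl, rfl⟩ := hxy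
      · rw [hFP, hFP]; exact (hpr a b).1 hab
      · rw [hFQ, hFQ, (hqr a b).1 hab]
    | refl => rfl
    | symm _ _ _ ih => exact ih.symm
    | trans _ _ _ _ _ ih₁ ih₂ => exact ih₁.trans ih₂
  have mid : ∀ c ∈ t', ∃ k : Fin q.upper, t'[(k : ℕ)]? = some c := by
    intro c hc
    obtain ⟨k, hk, rfl⟩ := List.getElem_of_mem hc
    exact ⟨⟨k, by omega⟩, by simp [hk]⟩
  have label : ∀ a : Fin q.upper ⊕ Fin q.lower, ∃ c ∈ t' ++ r, rowLabel t' r a = some c := by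
    rintro (a | a)
    · have ha : (a : ℕ) < t'.length := by omega
      exact ⟨t'[(a : ℕ)], by simp, by simp [rowLabel, ha]⟩
    · have ha : (a : ℕ) < r.length := by omega
      exact ⟨r[(a : ℕ)], by simp, by simp [rowLabel, ha]⟩
  have completeQ : ∀ a b, F (iotaQ p q h a) = F (iotaQ p q h b) →
      E (iotaQ p q h a) (iotaQ p q h b) := by
    intro a b hab
    obtain ⟨c, hc, hac⟩ := label a
    obtain ⟨d, hd, hbd⟩ := label b
    rw [hFQ, hFQ, hac, hbd] at hab
    have hcd : σ c = σ d := by simpa using hab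
    obtain rfl | ⟨hc', hd'⟩ := hinj c hc d hd hcd
    · exact EQ a b (hac.trans hbd.symm)
    · obtain ⟨k, hk⟩ := mid c hc'
      obtain ⟨m, hm⟩ := mid d hd'
      have h₁ : E (iotaQ p q h a) (iotaQ p q h (.inl k)) := EQ _ _ (hac.trans hk.symm)
      have h₃ : E (iotaQ p q h (.inl m)) (iotaQ p q h b) := EQ _ _ (hm.trans hbd.symm)
      have h₂ : E (iotaQ p q h (.inl k)) (iotaQ p q h (.inl m)) :=
        EP (.inr (Fin.cast h.symm k)) (.inr (Fin.cast h.symm m))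
          (by simp [rowLabel, ← hσ, hk, hm, hcd])
      exact E.trans h₁ (E.trans h₂ h₃)
  have cross : ∀ (i : Fin p.upper) (j : Fin q.lower), F (.inl i) = F (.inr (.inr j)) →
      E (.inl i) (.inr (.inr j)) := by
    intro i j hij
    have hi : (i : ℕ) < s.length := by omega
    have hj : (j : ℕ) < r.length := by omega
    have hij' : s[(i : ℕ)] = σ r[(j : ℕ)] := by simpa [F, rowLabel, hi, hj] using hij
    have hmem : s[(i : ℕ)] ∈ t :=
      hs _ (List.getElem_mem _) (hij' ▸ List.mem_map_of_mem (List.getElem_mem _))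
    rw [← hσ] at hmem
    obtain ⟨c, hc, hci⟩ := List.mem_map.1 hmem
    obtain ⟨k, hk⟩ := mid c hc
    have h₁ : E (.inl i) (iotaQ p q h (.inl k)) :=
      EP (.inl i) (.inr (Fin.cast h.symm k)) (by simp [rowLabel, ← hσ, hk, hci, hi])
    have h₂ : E (iotaQ p q h (.inl k)) (iotaQ p q h (.inr j)) :=
      completeQ _ _ ((sound _ _ h₁).symm.trans hij)
    exact E.trans h₁ h₂
  intro x y
  change E _ _ ↔ _
  rcases x with x | x <;> rcases y with y | y
  · exact ⟨sound _ _, EP (.inl x) (.inl y)⟩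
  · exact ⟨sound _ _, cross x y⟩
  · exact ⟨sound _ _, fun hxy => E.symm (cross y x hxy.symm)⟩
  · exact ⟨sound _ _, completeQ (.inr x) (.inr y)⟩

end HasRows

/-- The partition without upper points whose blocks are given by the word `w` lies in `M`. -/
def HasWord (M : Set PartitionDiagram) (w : List ℕ) : Prop :=
  ∃ p ∈ M, HasRows p [] w

end PartitionDiagram

section Words

variable {M : Set PartitionDiagram}

theorem IsPartitionCategory.hasRows_append_iff (hM : IsPartitionCategory M) (s t : List ℕ) :
    (∃ p ∈ M, HasRows p s t) ↔ HasWord M (s.reverse ++ t) := by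
  induction s generalizing t with
  | nil => rfl
  | cons a s ih =>
    rw [List.reverse_cons, List.append_assoc, List.singleton_append, ← ih]
    constructor
    · rintro ⟨p, hp, h⟩
      exact ⟨_, hM.rotLU_mem p hp (by simp [h.1]), h.rotLU _⟩
    · rintro ⟨p, hp, h⟩
      exact ⟨_, hM.rotLD_mem p hp (by simp [h.2.1]), h.rotLD _⟩

theorem IsPartitionCategory.append_hasRows_iff (hM : IsPartitionCategory M) (s t : List ℕ) :
    (∃ p ∈ M, HasRows p s t) ↔ HasWord M (t ++ s.reverse) := by
  induction s using List.reverseRecOn generalizing t with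
  | nil => simp [HasWord]
  | append_singleton s a ih =>
    rw [List.reverse_append, List.reverse_singleton, ← List.append_assoc, ← ih]
    constructor
    · rintro ⟨p, hp, h⟩
      exact ⟨_, hM.rotRU_mem p hp (by simp [h.1]), h.rotRU _⟩
    · rintro ⟨p, hp, h⟩
      exact ⟨_, hM.rotRD_mem p hp (by simp [h.2.1]), h.rotRD _⟩

namespace PartitionDiagram.HasWord

theorem rotate (hM : IsPartitionCategory M) {u v : List ℕ} (h : HasWord M (u ++ v)) :
    HasWord M (v ++ u) := by
  rw [← u.reverse_reverse] at h ⊢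
  exact (hM.append_hasRows_iff _ _).1 ((hM.hasRows_append_iff _ _).2 h)

theorem reverse (hM : IsPartitionCategory M) {w : List ℕ} (h : HasWord M w) :
    HasWord M w.reverse := by
  obtain ⟨p, hp, h⟩ := h
  simpa using (hM.hasRows_append_iff w []).1 ⟨_, hM.invol_mem p hp, h.invol⟩

theorem map_of_injective {w : List ℕ} (h : HasWord M w) {f : ℕ → ℕ}
    (hf : Function.Injective f) : HasWord M (w.map f) := by
  obtain ⟨p, hp, h⟩ := h
  exact ⟨p, hp, h.map hf⟩

theorem compose (hM : IsPartitionCategory M) {x t t' r : List ℕ} (σ : ℕ → ℕ)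
    (h₁ : HasWord M (x ++ t)) (h₂ : HasWord M (t'.reverse ++ r)) (hσ : t'.map σ = t)
    (hinj : ∀ a ∈ t' ++ r, ∀ b ∈ t' ++ r, σ a = σ b → a = b ∨ a ∈ t' ∧ b ∈ t')
    (hx : ∀ a ∈ x, a ∈ r.map σ → a ∈ t) : HasWord M (x ++ r.map σ) := by
  rw [← x.reverse_reverse] at h₁ ⊢
  obtain ⟨p, hp, h₁⟩ := (hM.hasRows_append_iff _ _).2 h₁
  obtain ⟨q, hq, h₂⟩ := (hM.hasRows_append_iff _ _).2 h₂
  have h : p.lower = q.upper := by rw [h₁.2.1, h₂.1, ← hσ, List.length_map]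
  exact (hM.hasRows_append_iff _ _).1
    ⟨_, hM.comp_mem p hp q hq h, h₁.comp h₂ h σ hσ hinj (by simpa using hx)⟩

theorem replace (hM : IsPartitionCategory M) {x r : List ℕ} (t : List ℕ)
    (h₁ : HasWord M (x ++ t)) (h₂ : HasWord M (t.reverse ++ r))
    (hx : ∀ a ∈ x, a ∈ r → a ∈ t) : HasWord M (x ++ r) := by
  simpa using compose hM id h₁ h₂ (by simp) (fun a _ b _ hab => .inl hab) (by simpa using hx)

theorem pair (hM : IsPartitionCategory M) (a : ℕ) : HasWord M [a, a] := by
  refine ⟨_, hM.pair_mem, .ofLabels rfl rfl (fun _ => a) ?_ fun _ _ _ => rfl⟩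
  rintro (⟨x, hx⟩ | ⟨x, hx⟩) <;> interval_cases x <;> rfl

theorem delete (hM : IsPartitionCategory M) {a : ℕ} {w : List ℕ}
    (h : HasWord M (a :: a :: w)) : HasWord M w :=
  replace hM (x := []) [a, a] (pair hM a) h (by simp)

theorem positioner (hM : IsGroupTheoreticalCategory M) {a b : ℕ} (hab : a ≠ b) :
    HasWord M [b, a, a, b, a, a] := by
  refine (hM.1.hasRows_append_iff [a, a, b] [b, a, a]).1
    ⟨_, hM.2, .ofLabels rfl rfl (fun n => if n = 0 then a else b) ?_ ?_⟩
  · rintro (⟨x, hx⟩ | ⟨x, hx⟩) <;> interval_cases x <;> rfl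
  · rintro (x | x) (y | y) <;> simp only [Sum.elim_inl, Sum.elim_inr] <;> split_ifs <;>
      simp_all [eq_comm]

theorem four (hM : IsGroupTheoreticalCategory M) (a : ℕ) : HasWord M [a, a, a, a] := by
  have h := positioner hM (Nat.succ_ne_self a).symm
  exact replace hM.1 (x := [a, a]) (r := [a, a]) [a + 1, a, a, a + 1]
    (rotate hM.1 (u := [_, _, _, _]) h) h (by simp)

theorem triple (hM : IsGroupTheoreticalCategory M) {a : ℕ} {w : List ℕ}
    (h : HasWord M (a :: w)) : HasWord M (a :: a :: a :: w) :=
  replace hM.1 (x := [a, a, a]) [a] (four hM a) h (by simp)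

theorem swap_pair (hM : IsGroupTheoreticalCategory M) {a b : ℕ} {w : List ℕ}
    (h : HasWord M (a :: a :: b :: w)) : HasWord M (b :: a :: a :: w) := by
  by_cases hab : a = b
  · exact hab ▸ h
  · exact replace hM.1 (x := [b, a, a]) [b, a, a] (positioner hM hab) h (by simp)

theorem move_pair (hM : IsGroupTheoreticalCategory M) {a : ℕ} {u w : List ℕ}
    (h : HasWord M (a :: a :: (u ++ w))) : HasWord M (u ++ a :: a :: w) := by
  induction u generalizing w with
  | nil => exact h
  | cons b u ih =>
    have h₁ : HasWord M (a :: a :: (u ++ (w ++ [b]))) := by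
      simpa using rotate hM.1 (u := [b]) (swap_pair hM h)
    have h₂ : HasWord M ((u ++ a :: a :: w) ++ [b]) := by simpa using ih h₁
    simpa using rotate hM.1 h₂

theorem merge_head (hM : IsGroupTheoreticalCategory M) {a c : ℕ} {w : List ℕ}
    (h : HasWord M (a :: c :: w)) :
    HasWord M (a :: a :: w.map (Function.update id c a)) := by
  by_cases hac : a = c
  · subst hac
    rwa [show Function.update id a a = id from Function.update_eq_self a _, List.map_id]
  refine compose hM.1 (x := [a, a]) (t := [a, a]) (t' := [c, a]) _ (four hM a) h
    (by simp [hac]) ?_ (by simp)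
  intro x _ y _ hxy
  by_cases hx : x = c <;> by_cases hy : y = c <;> simp_all

theorem merge_of_cons (hM : IsGroupTheoreticalCategory M) {a c : ℕ} {u v : List ℕ}
    (h : HasWord M (a :: (u ++ c :: v))) :
    HasWord M ((a :: (u ++ c :: v)).map (Function.update id c a)) := by
  have h₁ : HasWord M ((a :: u) ++ a :: a :: c :: v) :=
    move_pair hM (by simpa using triple hM h)
  have h₂ : HasWord M (a :: c :: (v ++ a :: u ++ [a])) := by
    simpa using rotate hM.1 (u := (a :: u) ++ [a]) (v := a :: c :: v) (by simpa using h₁)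
  have h₃ := merge_head hM h₂
  have ha : Function.update id c a a = a := by simp [Function.update_apply]
  simp only [List.map_append, List.map_cons, List.map_nil, ha, Function.update_self] at h₃ ⊢
  simpa using rotate hM.1 (v := a :: (u.map (Function.update id c a) ++ [a]))
    (by simpa using delete hM.1 h₃)

theorem merge (hM : IsGroupTheoreticalCategory M) (a c : ℕ) {w : List ℕ} (h : HasWord M w) :
    HasWord M (w.map (Function.update id c a)) := by
  by_cases hac : a = c
  · subst hac
    rwa [show Function.update id a a = id from Function.update_eq_self a _, List.map_id]
  by_cases ha : a ∈ w
  · obtain ⟨u, v, rfl⟩ := List.append_of_mem ha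
    have h' : HasWord M (a :: (v ++ u)) := by simpa using rotate hM.1 h
    by_cases hc : c ∈ v ++ u
    · obtain ⟨x, y, hxy⟩ := List.append_of_mem hc
      rw [hxy] at h'
      have h'' := merge_of_cons hM h'
      rw [← hxy, ← List.cons_append, List.map_append] at h''
      simpa using rotate hM.1 h''
    · have hid : (u ++ a :: v).map (Function.update id c a) = u ++ a :: v := by
        refine (List.map_congr_left fun x hx => ?_).trans (List.map_id _)
        refine Function.update_of_ne ?_ _ _
        rintro rfl
        simp_all [eq_comm]
      rwa [hid]
  · have hswap : w.map (Function.update id c a) = w.map (Equiv.swap c a) := by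
      refine List.map_congr_left fun x hx => ?_
      have hxa : x ≠ a := by rintro rfl; exact ha hx
      by_cases hxc : x = c
      · simp [hxc]
      · simp [hxc, Equiv.swap_apply_of_ne_of_ne hxc hxa]
    rw [hswap]
    exact h.map_of_injective (Equiv.injective _)

/-- The letters of a word may be identified arbitrarily. -/
theorem map (hM : IsGroupTheoreticalCategory M) {w : List ℕ} (h : HasWord M w) (f : ℕ → ℕ) :
    HasWord M (w.map f) := by
  obtain ⟨B, hB⟩ : ∃ B, ∀ x ∈ w, x < B :=
    ⟨w.sum + 1, fun x hx => Nat.lt_succ_of_le (List.le_sum_of_mem hx)⟩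
  obtain ⟨N, hN⟩ : ∃ N, ∀ x ∈ w, f x < N :=
    ⟨(w.map f).sum + 1, fun x hx =>
      Nat.lt_succ_of_le (List.le_sum_of_mem (List.mem_map_of_mem hx))⟩
  have key : ∀ k, HasWord M (w.map fun x => if x < k then f x else x + N) := by
    intro k
    induction k with
    | zero => simpa using h.map_of_injective (add_left_injective N)
    | succ k ih =>
      have ih' := merge hM (f k) (k + N) ih
      rw [List.map_map] at ih'
      convert ih' using 1
      refine List.map_congr_left fun x hx => ?_
      have := hN x hx
      obtain hxk | rfl | hxk := lt_trichotomy x k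
      · simp [hxk, hxk.trans (Nat.lt_succ_self k), Function.update_of_ne
          (show f x ≠ k + N by omega)]
      · simp
      · have h₁ : ¬ x < k + 1 := by omega
        have h₂ : ¬ x < k := by omega
        simp [h₁, h₂, Function.update_of_ne (show x + N ≠ k + N by omega)]
  convert key B using 1
  exact List.map_congr_left fun x hx => by simp [hB x hx]

theorem append (hM : IsGroupTheoreticalCategory M) {v w : List ℕ} (hv : HasWord M v)
    (hw : HasWord M w) : HasWord M (v ++ w) := by
  have hv' : HasWord M (v.map (2 * ·)) :=
    hv.map_of_injective fun x y hxy => by simpa using hxy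
  have hw' : HasWord M (w.map (2 * · + 1)) :=
    hw.map_of_injective fun x y hxy => by simpa using hxy
  have h : HasWord M (v.map (2 * ·) ++ w.map (2 * · + 1)) := by
    refine replace hM.1 [] (by simpa using hv') (by simpa using hw') ?_
    intro a ha ha'
    obtain ⟨x, -, rfl⟩ := List.mem_map.1 ha
    obtain ⟨y, -, hy⟩ := List.mem_map.1 ha'
    omega
  have h₁ : ((· / 2) ∘ (2 * ·) : ℕ → ℕ) = id := by ext x; simp
  have h₂ : ((· / 2) ∘ (2 * · + 1) : ℕ → ℕ) = id := by
    ext x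
    simp only [Function.comp_apply, id_eq]
    omega
  simpa only [List.map_append, List.map_map, h₁, h₂, List.map_id] using map hM h (· / 2)

end PartitionDiagram.HasWord

theorem gen_mul_self (n : ℕ) : gen n * gen n = 1 := by
  rw [gen, ← map_mul, ← ofAdd_add]
  exact map_one _

theorem gen_inv (n : ℕ) : (gen n)⁻¹ = gen n :=
  inv_eq_of_mul_eq_one_left (gen_mul_self n)

/-- Every element of `Z_2^{*∞}` is a product of generators. -/
theorem FreeZ2.exists_word (g : FreeZ2) : ∃ w : List ℕ, (w.map gen).prod = g := by
  induction g using Monoid.CoprodI.induction_on with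
  | one => exact ⟨[], rfl⟩
  | of i m =>
    obtain rfl | rfl : m = 1 ∨ m = Multiplicative.ofAdd (1 : ZMod 2) := by
      revert m; decide
    · exact ⟨[], (map_one _).symm⟩
    · exact ⟨[i], by simp [gen]⟩
  | mul x y hx hy =>
    obtain ⟨v, rfl⟩ := hx
    obtain ⟨w, rfl⟩ := hy
    exact ⟨v ++ w, by simp⟩

theorem prod_map_gen_reverse (w : List ℕ) :
    (w.reverse.map gen).prod = ((w.map gen).prod)⁻¹ := by
  simp only [List.prod_inv_reverse, List.map_map, List.map_reverse, Function.comp_def, gen_inv]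

namespace PartitionDiagram

theorem mem_Fmap_iff (hM : IsPartitionCategory M) {g : FreeZ2} :
    g ∈ Fmap M ↔ ∃ w, HasWord M w ∧ (w.map gen).prod = g := by
  constructor
  · rintro ⟨p, hp, lab, hlab, rfl⟩
    refine ⟨_, (hM.append_hasRows_iff (List.ofFn fun i => lab (.inl i))
      (List.ofFn fun j => lab (.inr j))).1 ⟨p, hp, by simp, by simp, fun x y => ?_⟩, ?_⟩
    · rw [← hlab]
      rcases x with x | x <;> rcases y with y | y <;> simp [rowLabel]
    · simp [wordOf, List.map_ofFn, Function.comp_def]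
  · rintro ⟨w, ⟨p, hp, hu, hl, hr⟩, rfl⟩
    have hlab : ∀ x : Fin p.upper ⊕ Fin p.lower, ∃ n, rowLabel [] w x = some n := by
      rintro (x | x)
      · exact (Fin.cast hu x).elim0
      · exact ⟨_, List.getElem?_eq_getElem (by omega)⟩
    choose lab hlab using hlab
    refine ⟨p, hp, lab, fun x y => ?_, ?_⟩
    · rw [hr, hlab, hlab, Option.some_inj]
    · have hw : List.ofFn (fun j => lab (.inr j)) = w := by
        refine List.ext_getElem (by simp [hl]) fun i h₁ h₂ => ?_
        have := hlab (.inr ⟨i, by omega⟩)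
        simp only [rowLabel, Sum.elim_inr, List.getElem?_eq_getElem h₂, Option.some_inj] at this
        simp [this]
      have he : List.ofFn (fun i => gen (lab (.inl i))) = [] := by
        simpa [List.ofFn_eq_nil_iff] using hu
      rw [wordOf, he, List.reverse_nil, List.append_nil]
      conv_rhs => rw [← hw]
      rw [List.map_ofFn]
      rfl

end PartitionDiagram
end Words

/-- The subgroup of `Z_2^{*∞}` formed by the words of a group-theoretical category. -/
def FmapSubgroup (M : Set PartitionDiagram) (hM : IsGroupTheoreticalCategory M) :
    Subgroup FreeZ2 where
  carrier := Fmap M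
  one_mem' := (mem_Fmap_iff hM.1).2 ⟨[0, 0], HasWord.pair hM.1 0, by simp [gen_mul_self]⟩
  mul_mem' := by
    intro x y hx hy
    obtain ⟨v, hv, rfl⟩ := (mem_Fmap_iff hM.1).1 hx
    obtain ⟨w, hw, rfl⟩ := (mem_Fmap_iff hM.1).1 hy
    exact (mem_Fmap_iff hM.1).2 ⟨v ++ w, hv.append hM hw, by simp⟩
  inv_mem' := by
    intro x hx
    obtain ⟨v, hv, rfl⟩ := (mem_Fmap_iff hM.1).1 hx
    exact (mem_Fmap_iff hM.1).2 ⟨v.reverse, hv.reverse hM.1, prod_map_gen_reverse v⟩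


/-- For every group-theoretical category of partitions `C`, the set `F(C)` is a
normal subgroup of `Z_2^{*∞}`. -/
theorem Fmap_isNormalSubgroup (M : Set PartitionDiagram)
    (hM : IsGroupTheoreticalCategory M) :
    ∃ H : Subgroup FreeZ2, H.Normal ∧ (H : Set FreeZ2) = Fmap M := by
  refine ⟨FmapSubgroup M hM, ⟨fun x hx g => ?_⟩, rfl⟩
  obtain ⟨v, hv, rfl⟩ := (mem_Fmap_iff hM.1).1 hx
  obtain ⟨u, rfl⟩ := FreeZ2.exists_word g
  refine (mem_Fmap_iff hM.1).2 ⟨u ++ v ++ u.reverse, ?_, by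
    rw [List.map_append, List.map_append, List.prod_append, List.prod_append,
      prod_map_gen_reverse]⟩
  induction u with
  | nil => simpa using hv
  | cons a u ih =>
    simpa using HasWord.rotate hM.1 (u := [a]) ((HasWord.pair hM.1 a).append hM ih)
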